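/- Let α ∈ ℂ be nonzero and let u, f, g, χ, A, B, R be C^∞ complex-valued functions on an open subset of ℝ² (variables x, y) satisfying: α f_y = f_{xx} − 2u f_x, α g_y = −g_{xx} − 2u g_x, α χ_y = −χ_{xx} − 2u χ_x; A_x = f g_x and α A_y = f_x g_x − f g_{xx} − 2u f g_x; B_x = f_x g and α B_y = f_{xx} g − f_x g_x − 2u f_x g; R_x = f χ_x and α R_y = f_x χ_x − f χ_{xx} − 2u f χ_x; A + B = f g; and A, B vanish nowhere. Set u[1] = u + A_x/A − B_x/B and χ[1] = χ − g R/A. Then α (χ[1])_y = −(χ[1])_{xx} − 2 u[1] (χ[1])_x. (Covariance of the adjoint spectral equation α χ_y = −χ_{xx} − 2u χ_x under the Darboux transformation, part of Theorems 4.1 and 4.2.) -/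

import Mathlib

noncomputable section

/-- Complex-valued functions of `(x, y) ∈ ℝ²`. -/
abbrev F2 := ℝ → ℝ → ℂ

/-- `C^∞` smoothness on a subset of `ℝ²`. -/
def Smooth2On (Ω : Set (ℝ × ℝ)) (f : F2) : Prop :=
  ContDiffOn ℝ (⊤ : ℕ∞) (fun p : ℝ × ℝ => f p.1 p.2) Ω

/-- partial derivative in `x`. -/
def px2 (f : F2) : F2 := fun x y => deriv (fun s => f s y) x

/-- partial derivative in `y`. -/
def py2 (f : F2) : F2 := fun x y => deriv (fun s => f x s) y

theorem Smooth2On.contDiffAt_fst {Ω : Set (ℝ × ℝ)} (hΩ : IsOpen Ω) {f : F2}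
    (hf : Smooth2On Ω f) {x y : ℝ} (h : (x, y) ∈ Ω) :
    ContDiffAt ℝ (⊤ : ℕ∞) (fun s => f s y) x :=
  ContDiffAt.comp (g := fun p : ℝ × ℝ => f p.1 p.2) (f := fun s : ℝ => (s, y)) x
    (ContDiffOn.contDiffAt hf (hΩ.mem_nhds h)) (contDiffAt_id.prodMk contDiffAt_const)

theorem Smooth2On.contDiffAt_snd {Ω : Set (ℝ × ℝ)} (hΩ : IsOpen Ω) {f : F2}
    (hf : Smooth2On Ω f) {x y : ℝ} (h : (x, y) ∈ Ω) :
    ContDiffAt ℝ (⊤ : ℕ∞) (fun s => f x s) y :=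
  ContDiffAt.comp (g := fun p : ℝ × ℝ => f p.1 p.2) (f := fun s : ℝ => (x, s)) y
    (ContDiffOn.contDiffAt hf (hΩ.mem_nhds h)) (contDiffAt_const.prodMk contDiffAt_id)

theorem Smooth2On.hasDerivAt_px2 {Ω : Set (ℝ × ℝ)} (hΩ : IsOpen Ω) {f : F2}
    (hf : Smooth2On Ω f) {x y : ℝ} (h : (x, y) ∈ Ω) :
    HasDerivAt (fun s => f s y) (px2 f x y) x :=
  ((hf.contDiffAt_fst hΩ h).differentiableAt (by simp)).hasDerivAt

theorem Smooth2On.hasDerivAt_py2 {Ω : Set (ℝ × ℝ)} (hΩ : IsOpen Ω) {f : F2}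
    (hf : Smooth2On Ω f) {x y : ℝ} (h : (x, y) ∈ Ω) :
    HasDerivAt (fun s => f x s) (py2 f x y) y :=
  ((hf.contDiffAt_snd hΩ h).differentiableAt (by simp)).hasDerivAt

theorem Smooth2On.hasDerivAt_px2_px2 {Ω : Set (ℝ × ℝ)} (hΩ : IsOpen Ω) {f : F2}
    (hf : Smooth2On Ω f) {x y : ℝ} (h : (x, y) ∈ Ω) :
    HasDerivAt (fun s => px2 f s y) (px2 (px2 f) x y) x :=
  ((((hf.contDiffAt_fst hΩ h).fderiv_right (m := 1) (by norm_cast)).differentiableAt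
    one_ne_zero).clm_apply (differentiableAt_const (1 : ℝ))).hasDerivAt

/-- Covariance of the adjoint spectral equation `α χ_y = -χ_xx - 2u χ_x` under the
Darboux transformation (part of Theorems 4.1 and 4.2). -/
theorem darboux_covariance_adjoint_spectral_equation
    (α : ℂ) (hα : α ≠ 0) (Ω : Set (ℝ × ℝ)) (hΩ : IsOpen Ω)
    (u f g χ A B R : F2)
    (hu : Smooth2On Ω u) (hf : Smooth2On Ω f) (hg : Smooth2On Ω g)
    (hχ : Smooth2On Ω χ) (hA : Smooth2On Ω A) (hB : Smooth2On Ω B)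
    (hR : Smooth2On Ω R)
    (hfe : ∀ x y, (x, y) ∈ Ω →
      α * py2 f x y = px2 (px2 f) x y - 2 * u x y * px2 f x y)
    (hge : ∀ x y, (x, y) ∈ Ω →
      α * py2 g x y = -(px2 (px2 g) x y) - 2 * u x y * px2 g x y)
    (hχe : ∀ x y, (x, y) ∈ Ω →
      α * py2 χ x y = -(px2 (px2 χ) x y) - 2 * u x y * px2 χ x y)
    (hAx : ∀ x y, (x, y) ∈ Ω → px2 A x y = f x y * px2 g x y)
    (hAy : ∀ x y, (x, y) ∈ Ω →
      α * py2 A x y = px2 f x y * px2 g x y - f x y * px2 (px2 g) x y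
        - 2 * u x y * f x y * px2 g x y)
    (hBx : ∀ x y, (x, y) ∈ Ω → px2 B x y = px2 f x y * g x y)
    (hBy : ∀ x y, (x, y) ∈ Ω →
      α * py2 B x y = px2 (px2 f) x y * g x y - px2 f x y * px2 g x y
        - 2 * u x y * px2 f x y * g x y)
    (hRx : ∀ x y, (x, y) ∈ Ω → px2 R x y = f x y * px2 χ x y)
    (hRy : ∀ x y, (x, y) ∈ Ω →
      α * py2 R x y = px2 f x y * px2 χ x y - f x y * px2 (px2 χ) x y
        - 2 * u x y * f x y * px2 χ x y)
    (hAB : ∀ x y, (x, y) ∈ Ω → A x y + B x y = f x y * g x y)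
    (hAne : ∀ x y, (x, y) ∈ Ω → A x y ≠ 0)
    (hBne : ∀ x y, (x, y) ∈ Ω → B x y ≠ 0)
    (u1 : F2) (hu1 : u1 = fun x y =>
      u x y + px2 A x y / A x y - px2 B x y / B x y)
    (χ1 : F2) (hχ1 : χ1 = fun x y => χ x y - g x y * R x y / A x y) :
    ∀ x y, (x, y) ∈ Ω →
      α * py2 χ1 x y = -(px2 (px2 χ1) x y) - 2 * u1 x y * px2 χ1 x y := by
  subst hu1 hχ1
  have hχ1x : ∀ x y, (x, y) ∈ Ω →
      px2 (fun x y => χ x y - g x y * R x y / A x y) x y =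
        -(B x y / A x y) * (px2 χ x y - px2 g x y * R x y / A x y) := by
    intro x y h
    have hA0 := hAne x y h
    have hd := (hχ.hasDerivAt_px2 hΩ h).sub
      (((hg.hasDerivAt_px2 hΩ h).mul (hR.hasDerivAt_px2 hΩ h)).div
        (hA.hasDerivAt_px2 hΩ h) hA0)
    refine hd.deriv.trans ?_
    simp only [Pi.mul_apply]
    rw [hRx x y h, hAx x y h, eq_sub_of_add_eq' (hAB x y h)]
    field_simp
    ring
  intro x y h
  have hA0 := hAne x y h
  have hB0 := hBne x y h
  have hev : ∀ᶠ s in nhds x, (s, y) ∈ Ω :=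
    (by fun_prop : ContinuousAt (fun s : ℝ => (s, y)) x).eventually_mem (hΩ.mem_nhds h)
  have hχ1xx : px2 (px2 (fun x y => χ x y - g x y * R x y / A x y)) x y = _ :=
    (Filter.EventuallyEq.deriv_eq (hev.mono fun s hs => hχ1x s y hs)).trans
      ((((hB.hasDerivAt_px2 hΩ h).div (hA.hasDerivAt_px2 hΩ h) hA0).neg.mul
        ((hχ.hasDerivAt_px2_px2 hΩ h).sub
          (((hg.hasDerivAt_px2_px2 hΩ h).mul (hR.hasDerivAt_px2 hΩ h)).div
            (hA.hasDerivAt_px2 hΩ h) hA0))).deriv)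
  have hχ1y : py2 (fun x y => χ x y - g x y * R x y / A x y) x y = _ :=
    ((hχ.hasDerivAt_py2 hΩ h).sub
      (((hg.hasDerivAt_py2 hΩ h).mul (hR.hasDerivAt_py2 hΩ h)).div
        (hA.hasDerivAt_py2 hΩ h) hA0)).deriv
  rw [hχ1xx, hχ1y, hχ1x x y h]
  simp only [Pi.mul_apply, Pi.neg_apply, Pi.sub_apply, Pi.div_apply]
  have hy : ∀ c r a k : ℂ, α * (c - ((k * R x y + g x y * r) * A x y
        - g x y * R x y * a) / A x y ^ 2) =
      α * c - ((α * k * R x y + g x y * (α * r)) * A x y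
        - g x y * R x y * (α * a)) / A x y ^ 2 := by
    intros; ring
  rw [hy, hχe x y h, hge x y h, hRy x y h, hAy x y h, hRx x y h, hAx x y h, hBx x y h]
  have hBe := eq_sub_of_add_eq' (hAB x y h)
  field_simp
  rw [hBe]
  ring

end
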